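/- Let X be a local dendrite, let G be a proper subcontinuum of X containing every simple closed curve of X, and let C be a connected component of X ∖ G. Then: (1) C is open in X; (2) the closure of C in X is a dendrite; and (3) the intersection of the closure of C with G consists of exactly one point. -/

import Mathlib

open Topology

/-- A continuum: a nonempty compact connected metrizable topological space. -/
def IsContinuum (X : Type*) [TopologicalSpace X] : Prop :=
  Nonempty X ∧ CompactSpace X ∧ ConnectedSpace X ∧ TopologicalSpace.MetrizableSpace X

/-- A simple closed curve in `X`: a subspace homeomorphic to the circle. -/
def IsSimpleClosedCurve {X : Type*} [TopologicalSpace X] (S : Set X) : Prop :=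
  Nonempty (S ≃ₜ AddCircle (1 : ℝ))

/-- A dendrite: a locally connected continuum containing no simple closed curve. -/
def IsDendrite (X : Type*) [TopologicalSpace X] : Prop :=
  IsContinuum X ∧ LocallyConnectedSpace X ∧ ∀ S : Set X, ¬ IsSimpleClosedCurve S

/-- A local dendrite: a continuum each of whose points has a neighborhood
that is a dendrite. -/
def IsLocalDendrite (X : Type*) [TopologicalSpace X] : Prop :=
  IsContinuum X ∧ ∀ x : X, ∃ N : Set X, N ∈ 𝓝 x ∧ IsDendrite N

/-- A branch point of `X`: a point whose complement has at least three
connected components. -/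
def IsBranchPoint {X : Type*} [TopologicalSpace X] (x : X) : Prop :=
  ∃ u v w : ConnectedComponents (↥({x}ᶜ : Set X)), u ≠ v ∧ u ≠ w ∧ v ≠ w

/-- `X ∖ {x}` has countably infinitely many connected components
(i.e. there are ℵ₀ branches at `x`). -/
def HasAlephNullBranchesAt (X : Type*) [TopologicalSpace X] (x : X) : Prop :=
  Countable (ConnectedComponents (↥({x}ᶜ : Set X))) ∧
    Infinite (ConnectedComponents (↥({x}ᶜ : Set X)))

section

open Set Filter Metric unitInterval

theorem IsPreconnected.exists_chain_dist_lt {X : Type*} [PseudoMetricSpace X] {A : Set X}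
    (hA : IsPreconnected A) {x y : X} (hx : x ∈ A) (hy : y ∈ A) {δ : ℝ} (hδ : 0 < δ) :
    ∃ (c : ℕ → X) (N : ℕ), c 0 = x ∧ (∀ i, N ≤ i → c i = y) ∧ (∀ i, c i ∈ A) ∧
      ∀ i, dist (c i) (c (i + 1)) < δ := by
  let R : A → A → Prop := fun u v => dist (u : X) v < δ
  have hconn : Relation.ReflTransGen R ⟨x, hx⟩ ⟨y, hy⟩ := by
    have : PreconnectedSpace A := Subtype.preconnectedSpace hA
    have : Std.Symm R := ⟨fun a b h => by simpa [R, dist_comm] using h⟩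
    refine PreconnectedSpace.induction₂ (Relation.ReflTransGen R) (fun u => ?_)
      ⟨fun _ _ _ h₁ h₂ => h₁.trans h₂⟩ _ _
    filter_upwards [Metric.ball_mem_nhds u hδ] with v hv
    exact .single (by rwa [mem_ball, dist_comm] at hv)
  suffices ∀ u : A, Relation.ReflTransGen R u ⟨y, hy⟩ → ∃ (c : ℕ → X) (N : ℕ), c 0 = u ∧
      (∀ i, N ≤ i → c i = y) ∧ (∀ i, c i ∈ A) ∧ ∀ i, dist (c i) (c (i + 1)) < δ from
    this ⟨x, hx⟩ hconn
  intro u hu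
  induction hu using Relation.ReflTransGen.head_induction_on with
  | refl => exact ⟨fun _ => y, 0, rfl, fun _ _ => rfl, fun _ => hy, fun _ => by simpa using hδ⟩
  | @head a b hab _ ih =>
    obtain ⟨c, N, h0, hN, hc, hd⟩ := ih
    refine ⟨fun n => Nat.casesOn n a c, N + 1, rfl, ?_, ?_, ?_⟩
    · rintro (_ | i) hi
      · omega
      · exact hN i (by omega)
    · rintro (_ | i)
      · exact a.2
      · exact hc i
    · rintro (_ | i)
      · simpa [h0] using hab
      · exact hd i

/-- In a compact locally connected metric space, nearby points lie in small connected sets. -/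
theorem exists_isPreconnected_subset_closedBall {X : Type*} [PseudoMetricSpace X] [CompactSpace X]
    [LocallyConnectedSpace X] {ε : ℝ} (hε : 0 < ε) :
    ∃ δ > 0, ∀ x y : X, dist x y < δ →
      ∃ A : Set X, IsPreconnected A ∧ x ∈ A ∧ y ∈ A ∧ A ⊆ closedBall x ε := by
  have key : ∀ z : X, ∃ V : Set X, IsOpen V ∧ z ∈ V ∧ IsConnected V ∧ V ⊆ ball z (ε / 2) := by
    intro z
    obtain ⟨V, ⟨h1, h2, h3⟩, h4⟩ := (LocallyConnectedSpace.open_connected_basis z).mem_iff.1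
      (ball_mem_nhds z (half_pos hε))
    exact ⟨V, h1, h2, h3, h4⟩
  choose V hVo hzV hVc hVb using key
  obtain ⟨δ, hδ, H⟩ := lebesgue_number_lemma_of_metric (isCompact_univ (X := X)) hVo
    (fun z _ => mem_iUnion.2 ⟨z, hzV z⟩)
  refine ⟨δ, hδ, fun x y hxy => ?_⟩
  obtain ⟨z, hz⟩ := H x (mem_univ x)
  have hxz : x ∈ V z := hz (mem_ball_self hδ)
  refine ⟨V z, (hVc z).isPreconnected, hxz, hz (by simpa [dist_comm] using hxy), fun w hw => ?_⟩
  have h1 := hVb z hw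
  have h2 := hVb z hxz
  rw [mem_ball] at h1 h2
  rw [mem_closedBall]
  linarith [dist_triangle_right w x z]

/-- Refining a `δ`-chain into a `δ'`-chain which stays within `ε` of it. -/
theorem exists_refined_chain {X : Type*} [PseudoMetricSpace X] {ε δ δ' : ℝ} (hδ' : 0 < δ')
    (hε : 0 ≤ ε)
    (H : ∀ x y : X, dist x y < δ →
      ∃ A : Set X, IsPreconnected A ∧ x ∈ A ∧ y ∈ A ∧ A ⊆ closedBall x ε)
    {M : ℕ} {f : ℕ → X} {y : X} (hf : ∀ i, dist (f i) (f (i + 1)) < δ)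
    (hM : ∀ i, M ≤ i → f i = y) :
    ∃ (N : ℕ) (g : ℕ → X), 0 < N ∧ g 0 = f 0 ∧ (∀ i, dist (g i) (g (i + 1)) < δ') ∧
      (∀ i, M * N ≤ i → g i = y) ∧ ∀ i, dist (f (i / N)) (g i) ≤ ε := by
  have chain : ∀ j, ∃ (c : ℕ → X) (n : ℕ), c 0 = f j ∧ (∀ i, n ≤ i → c i = f (j + 1)) ∧
      (∀ i, c i ∈ closedBall (f j) ε) ∧ (∀ i, dist (c i) (c (i + 1)) < δ') ∧
      (M ≤ j → ∀ i, c i = y) := by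
    intro j
    by_cases hj : M ≤ j
    · exact ⟨fun _ => y, 0, (hM j hj).symm, fun _ _ => (hM _ (by omega)).symm,
        fun _ => by rw [hM j hj]; exact mem_closedBall_self hε, fun _ => by simpa using hδ',
        fun _ _ => rfl⟩
    · obtain ⟨A, hA, h1, h2, h3⟩ := H _ _ (hf j)
      obtain ⟨c, n, h4, h5, h6, h7⟩ := hA.exists_chain_dist_lt h1 h2 hδ'
      exact ⟨c, n, h4, h5, fun i => h3 (h6 i), h7, fun h => absurd h hj⟩
  choose c n hc0 hcn hcε hcδ hcM using chain
  set N := (Finset.range M).sup n + 1 with hN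
  have hNpos : 0 < N := by omega
  have hcN : ∀ j, c j N = f (j + 1) := by
    intro j
    by_cases hj : M ≤ j
    · rw [hcM j hj, hM _ (by omega)]
    · refine hcn j N ?_
      have := Finset.le_sup (f := n) (Finset.mem_range.2 (not_le.1 hj))
      omega
  refine ⟨N, fun i => c (i / N) (i % N), hNpos, by simp [hc0], fun i => ?_, fun i hi => ?_,
    fun i => ?_⟩
  · rcases lt_or_ge (i % N + 1) N with h | h
    · have e1 : (i + 1) / N = i / N := by
        rw [Nat.add_div hNpos, Nat.div_eq_of_lt (a := 1) (by omega),
          Nat.mod_eq_of_lt (a := 1) (by omega), if_neg (by omega)]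
        omega
      have e2 : (i + 1) % N = i % N + 1 := by
        rw [← Nat.mod_add_mod, Nat.mod_eq_of_lt h]
      simp only [e1, e2]
      exact hcδ _ _
    · have hlt := Nat.mod_lt i hNpos
      have hd := Nat.div_add_mod i N
      have e0 : i + 1 = N * (i / N + 1) := by rw [mul_add, mul_one]; omega
      have e1 : (i + 1) / N = i / N + 1 := by rw [e0, Nat.mul_div_cancel_left _ hNpos]
      have e2 : (i + 1) % N = 0 := by rw [e0, Nat.mul_mod_right]
      have e3 : i % N + 1 = N := by omega
      have := hcδ (i / N) (i % N)
      rw [e3, hcN] at this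
      simpa only [e1, e2, hc0] using this
  · exact hcM _ ((Nat.le_div_iff_mul_le hNpos).2 hi) _
  · simpa [dist_comm] using hcε (i / N) (i % N)

/-- In a compact locally connected metric space, nearby points are joined by small paths. -/
theorem exists_joinedIn_closedBall {X : Type*} [MetricSpace X] [CompactSpace X]
    [LocallyConnectedSpace X] {ε : ℝ} (hε : 0 < ε) :
    ∃ δ > 0, ∀ x y : X, dist x y < δ → JoinedIn (closedBall x ε) x y := by
  have hk : ∀ k : ℕ, ∃ δ > 0, δ ≤ ε / 2 ^ k ∧ ∀ x y : X, dist x y < δ →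
      ∃ A : Set X, IsPreconnected A ∧ x ∈ A ∧ y ∈ A ∧ A ⊆ closedBall x (ε / 2 / 2 ^ k) := by
    intro k
    obtain ⟨δ, h1, h2⟩ := exists_isPreconnected_subset_closedBall (X := X)
      (ε := ε / 2 / 2 ^ k) (by positivity)
    exact ⟨min δ (ε / 2 ^ k), lt_min h1 (by positivity), min_le_right _ _,
      fun x y h => h2 x y (h.trans_le (min_le_left _ _))⟩
  choose δ hδ hδε H using hk
  refine ⟨δ 0, hδ 0, fun x y hxy => ?_⟩
  let P : ℕ → ℕ × (ℕ → X) → Prop := fun k s => 0 < s.1 ∧ s.2 0 = x ∧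
    (∀ i, dist (s.2 i) (s.2 (i + 1)) < δ k) ∧ ∀ i, s.1 ≤ i → s.2 i = y
  have step : ∀ k (s : ℕ × (ℕ → X)), ∃ (N : ℕ) (g : ℕ → X), P k s →
      0 < N ∧ P (k + 1) (s.1 * N, g) ∧ ∀ i, dist (s.2 (i / N)) (g i) ≤ ε / 2 / 2 ^ k := by
    intro k s
    by_cases hs : P k s
    · obtain ⟨N, g, h1, h2, h3, h4, h5⟩ := exists_refined_chain (hδ (k + 1)) (by positivity)
        (H k) hs.2.2.1 hs.2.2.2
      exact ⟨N, g, fun _ => ⟨h1, ⟨Nat.mul_pos hs.1 h1, h2.trans hs.2.1, h3, h4⟩, h5⟩⟩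
    · exact ⟨0, s.2, fun h => absurd h hs⟩
  choose N g hNg using step
  let s : ℕ → ℕ × (ℕ → X) := fun k => Nat.rec (1, fun i => if i = 0 then x else y)
    (fun k s => (s.1 * N k s, g k s)) k
  have hs : ∀ k, P k (s k) := by
    intro k
    induction k with
    | zero =>
      refine ⟨one_pos, rfl, fun i => ?_, fun i hi => if_neg (Nat.one_le_iff_ne_zero.1 hi)⟩
      cases i with
      | zero => simpa [s] using hxy
      | succ i => simpa [s] using hδ 0
    | succ k ih => exact (hNg k (s k) ih).2.1
  let F : ℕ → I → X := fun k t => (s k).2 ⌊(t : ℝ) * (s k).1⌋₊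
  have hF : ∀ t k, dist (F k t) (F (k + 1) t) ≤ ε / 2 / 2 ^ k := by
    intro t k
    obtain ⟨h1, h2, h3⟩ := hNg k (s k) (hs k)
    have : ⌊(t : ℝ) * (s k).1⌋₊ = ⌊(t : ℝ) * (s (k + 1)).1⌋₊ / N k (s k) := by
      rw [← Nat.floor_div_natCast]
      congr 1
      have : (N k (s k) : ℝ) ≠ 0 := by positivity
      change _ = (t : ℝ) * ((s k).1 * N k (s k) : ℕ) / _
      push_cast
      field_simp
    simp only [F, this]
    exact h3 _
  have hlim : ∀ t, ∃ z, Tendsto (fun k => F k t) atTop (𝓝 z) := fun t =>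
    cauchySeq_tendsto_of_complete (cauchySeq_of_le_geometric_two (hF t))
  choose G hG using hlim
  have hFG : ∀ t k, dist (F k t) (G t) ≤ ε / 2 ^ k := fun t k =>
    dist_le_of_le_geometric_two_of_tendsto (hF t) (hG t) k
  have hF0 : ∀ k, F k 0 = x := fun k => by simpa [F] using (hs k).2.1
  have hF1 : ∀ k, F k 1 = y := fun k => by simpa [F] using (hs k).2.2.2 _ le_rfl
  have hG0 : G 0 = x := tendsto_nhds_unique (hG 0) (by simp [hF0])
  have hG1 : G 1 = y := tendsto_nhds_unique (hG 1) (by simp [hF1])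
  have hFc : ∀ k (a b : I), a ≤ b → (b : ℝ) - a < 1 / (s k).1 → dist (F k a) (F k b) < ε / 2 ^ k := by
    intro k a b hab h
    have hpos : (0 : ℝ) < (s k).1 := Nat.cast_pos.2 (hs k).1
    have h1 : ⌊(a : ℝ) * (s k).1⌋₊ ≤ ⌊(b : ℝ) * (s k).1⌋₊ :=
      Nat.floor_mono (mul_le_mul_of_nonneg_right hab hpos.le)
    have h2 : ⌊(b : ℝ) * (s k).1⌋₊ ≤ ⌊(a : ℝ) * (s k).1⌋₊ + 1 := by
      rw [← Nat.floor_add_one (mul_nonneg a.2.1 hpos.le)]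
      refine Nat.floor_mono ?_
      rw [lt_div_iff₀ hpos] at h
      linarith
    rcases (by omega : ⌊(b : ℝ) * (s k).1⌋₊ = ⌊(a : ℝ) * (s k).1⌋₊ ∨
      ⌊(b : ℝ) * (s k).1⌋₊ = ⌊(a : ℝ) * (s k).1⌋₊ + 1) with h | h
    · simp only [F, h, dist_self]
      positivity
    · simp only [F, h]
      exact ((hs k).2.2.1 _).trans_le (hδε k)
  have hGc : Continuous G := by
    refine Metric.continuous_iff.2 fun b η hη => ?_
    obtain ⟨k, hk⟩ : ∃ k : ℕ, 3 * ε * (1 / 2) ^ k < η := by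
      have : Tendsto (fun k : ℕ => 3 * ε * (1 / 2 : ℝ) ^ k) atTop (𝓝 (3 * ε * 0)) :=
        (tendsto_pow_atTop_nhds_zero_of_lt_one (by norm_num) (by norm_num)).const_mul _
      rw [mul_zero] at this
      exact (this.eventually_lt_const hη).exists
    have hpos : (0 : ℝ) < (s k).1 := Nat.cast_pos.2 (hs k).1
    refine ⟨1 / (s k).1, by positivity, fun a hab => ?_⟩
    have : dist (F k a) (F k b) < ε / 2 ^ k := by
      rw [Subtype.dist_eq, Real.dist_eq, abs_lt] at hab
      rcases le_total a b with h | h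
      · exact hFc k a b h (by linarith)
      · rw [dist_comm]
        exact hFc k b a h (by linarith)
    have e : 3 * ε * (1 / 2) ^ k = 3 * (ε / 2 ^ k) := by rw [one_div, inv_pow]; ring
    have h1 := hFG a k
    have h2 := hFG b k
    have h3 := dist_triangle4 (G a) (F k a) (F k b) (G b)
    rw [dist_comm (G a) (F k a)] at h3
    linarith
  refine ⟨⟨⟨G, hGc⟩, hG0, hG1⟩, fun t => ?_⟩
  rw [mem_closedBall]
  change dist (G t) x ≤ ε
  rcases eq_or_ne t 1 with rfl | ht
  · rw [hG1, dist_comm]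
    simpa using hxy.le.trans (hδε 0)
  · have ht1 : (t : ℝ) < 1 := lt_of_le_of_ne t.2.2 fun h => ht (Subtype.ext h)
    have : F 0 t = x := by
      have : ⌊(t : ℝ) * (s 0).1⌋₊ = 0 := by simpa [s, Nat.floor_eq_zero] using ht1
      simp only [F, this]
      exact (hs 0).2.1
    simpa [this, dist_comm] using hFG t 0

/-- Compact locally connected metric spaces are locally path connected. -/
theorem LocallyPathConnectedSpace.of_compactSpace_of_locallyConnectedSpace {X : Type*}
    [MetricSpace X] [CompactSpace X] [LocallyConnectedSpace X] : LocallyPathConnectedSpace X := by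
  refine locallyPathConnectedSpace_iff_pathComponentIn_mem_nhds.2 fun x u hu hxu => ?_
  obtain ⟨ε, hε, hb⟩ := Metric.nhds_basis_closedBall.mem_iff.1 (hu.mem_nhds hxu)
  obtain ⟨δ, hδ, H⟩ := exists_joinedIn_closedBall (X := X) hε
  filter_upwards [ball_mem_nhds x hδ] with y hy
  exact (H x y (by simpa [dist_comm] using hy)).mono hb

theorem IsCompact.exists_Icc_inter_eq_empty_of_isChain {α : Type*} [LinearOrder α]
    [TopologicalSpace α] [CompactIccSpace α] {c : Set (Set α)} (hc : IsChain (· ⊆ ·) c)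
    (hne : c.Nonempty) (hcl : ∀ K ∈ c, IsClosed K) {a b : α} (h : Icc a b ∩ ⋂₀ c = ∅) :
    ∃ K ∈ c, Icc a b ∩ K = ∅ := by
  have : Nonempty c := hne.to_subtype
  obtain ⟨K, hK⟩ := isCompact_Icc.elim_directed_family_closed (fun K : c => (K : Set α))
    (fun K => hcl K K.2) (by rwa [← sInter_eq_iInter])
    (fun K L => (hc.total K.2 L.2).elim (fun h => ⟨K, subset_rfl, h⟩) fun h => ⟨L, h, subset_rfl⟩)
  exact ⟨K, K.2, hK⟩

/-- `IsReduction f K`: the closed set `K` contains both endpoints and `f` takes equal values at the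
two ends of every gap of `K`, so that `f` remains a path after the gaps have been cut out. -/
structure IsReduction {X : Type*} (f : I → X) (K : Set I) : Prop where
  isClosed : IsClosed K
  zero_mem : 0 ∈ K
  one_mem : 1 ∈ K
  eq_of_gap : ∀ a ∈ K, ∀ b ∈ K, a < b → Ioo a b ∩ K = ∅ → f a = f b

theorem IsReduction.sInter {X : Type*} [TopologicalSpace X] [T2Space X] {f : I → X}
    (hf : Continuous f) {c : Set (Set I)} (hc : IsChain (· ⊆ ·) c) (hne : c.Nonempty)
    (h : ∀ K ∈ c, IsReduction f K) : IsReduction f (⋂₀ c) := by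
  refine ⟨isClosed_sInter fun K hK => (h K hK).isClosed, fun K hK => (h K hK).zero_mem,
    fun K hK => (h K hK).one_mem, fun a ha b hb hab hgap => ?_⟩
  by_contra hne'
  obtain ⟨U, V, hU, hV, haU, hbV, hUV⟩ := t2_separation hne'
  obtain ⟨u, hau, hu⟩ := (mem_nhdsGE_iff_exists_Ico_subset' hab).1
    (mem_nhdsWithin_of_mem_nhds ((hU.preimage hf).mem_nhds haU))
  obtain ⟨l, hlb, hl⟩ := (mem_nhdsLE_iff_exists_Ioc_subset' hab).1
    (mem_nhdsWithin_of_mem_nhds ((hV.preimage hf).mem_nhds hbV))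
  obtain ⟨a', haa', ha'⟩ := exists_between (lt_min hau hab)
  obtain ⟨b', hlb', hbb'⟩ := exists_between (max_lt hlb hab)
  have hgap' : Icc a' b' ∩ ⋂₀ c = ∅ := by
    refine eq_empty_of_subset_empty fun z hz => ?_
    rw [← hgap]
    exact ⟨⟨haa'.trans_le hz.1.1, hz.1.2.trans_lt hbb'⟩, hz.2⟩
  obtain ⟨K, hKc, hK⟩ := IsCompact.exists_Icc_inter_eq_empty_of_isChain hc hne
    (fun K hK => (h K hK).isClosed) hgap'
  obtain ⟨α, hα, hαm⟩ := ((h K hKc).isClosed.inter isClosed_Iic).isCompact.exists_isGreatest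
    (s := K ∩ Iic a') ⟨a, ha K hKc, haa'.le⟩
  obtain ⟨β, hβ, hβm⟩ := ((h K hKc).isClosed.inter isClosed_Ici).isCompact.exists_isLeast
    (s := K ∩ Ici b') ⟨b, hb K hKc, hbb'.le⟩
  have hα' : f α ∈ U := hu ⟨hαm ⟨ha K hKc, haa'.le⟩, hα.2.trans_lt (ha'.trans_le (min_le_left _ _))⟩
  have hβ' : f β ∈ V :=
    hl ⟨((le_max_left _ _).trans_lt hlb').trans_le hβ.2, hβm ⟨hb K hKc, hbb'.le⟩⟩
  have hlt : α < β := by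
    by_contra hle
    rw [not_lt] at hle
    refine disjoint_left.1 hUV hα' (hl ⟨?_, ?_⟩)
    · exact ((le_max_left _ _).trans_lt hlb').trans_le (hβ.2.trans hle)
    · exact hα.2.trans (ha'.trans_le (min_le_right _ _)).le
  refine disjoint_left.1 hUV hα' ?_
  rw [(h K hKc).eq_of_gap α hα.1 β hβ.1 hlt (eq_empty_of_subset_empty fun z hz => ?_)]
  · exact hβ'
  · rw [← hK]
    refine ⟨⟨?_, ?_⟩, hz.2⟩
    · exact le_of_not_ge fun hza => (hαm ⟨hz.2, hza⟩).not_gt hz.1.1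
    · exact le_of_not_ge fun hza => (hβm ⟨hz.2, hza⟩).not_gt hz.1.2

theorem IsReduction.sdiff_Ioo {X : Type*} {f : I → X} {K : Set I} (h : IsReduction f K) {s t : I}
    (hs : s ∈ K) (ht : t ∈ K) (hf : f s = f t) : IsReduction f (K \ Ioo s t) := by
  refine ⟨h.isClosed.sdiff isOpen_Ioo, ⟨h.zero_mem, fun h => h.1.not_ge unitInterval.nonneg'⟩,
    ⟨h.one_mem, fun h => h.2.not_ge unitInterval.le_one'⟩, fun a ha b hb hab hgap => ?_⟩
  by_cases hK : Ioo a b ∩ K = ∅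
  · exact h.eq_of_gap a ha.1 b hb.1 hab hK
  · obtain ⟨u, hu, huK⟩ := nonempty_iff_ne_empty.2 hK
    have hgap' : ∀ z ∈ K, a < z → z < b → s < z ∧ z < t := fun z hz h1 h2 => by
      by_contra hzst
      exact (hgap.subset ⟨⟨h1, h2⟩, hz, hzst⟩ : z ∈ (∅ : Set I))
    obtain ⟨hsu, hut⟩ := hgap' u huK hu.1 hu.2
    have has : a ≤ s := le_of_not_gt fun h => ha.2 ⟨h, hu.1.trans hut⟩
    have htb : t ≤ b := le_of_not_gt fun h => hb.2 ⟨hsu.trans hu.2, h⟩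
    have has' : a = s := has.eq_or_lt.resolve_right fun h =>
      (hgap' s hs h (hsu.trans hu.2)).1.false
    have htb' : t = b := htb.eq_or_lt.resolve_right fun h =>
      (hgap' t ht (hu.1.trans hut) h).2.false
    rw [has', ← htb', hf]

theorem exists_isReduction_inter_Ioo_eq_empty {X : Type*} [TopologicalSpace X] [T2Space X]
    {f : I → X} (hf : Continuous f) : ∃ K, IsReduction f K ∧
      ∀ s ∈ K, ∀ t ∈ K, s < t → f s = f t → K ∩ Ioo s t = ∅ := by
  have huniv : IsReduction f univ := ⟨isClosed_univ, mem_univ _, mem_univ _, fun a _ b _ hab h => by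
    obtain ⟨z, hz⟩ := exists_between hab
    exact absurd h (nonempty_iff_ne_empty.1 ⟨z, hz, mem_univ z⟩)⟩
  obtain ⟨K, -, hK⟩ := zorn_superset_nonempty {K | IsReduction f K}
    (fun c hc hchain hne => ⟨⋂₀ c, IsReduction.sInter hf hchain hne hc,
      fun s hs => sInter_subset_of_mem hs⟩) univ huniv
  refine ⟨K, hK.prop, fun s hs t ht _ hst => ?_⟩
  have := hK.le_of_le (hK.prop.sdiff_Ioo hs ht hst) sdiff_subset
  exact eq_empty_of_subset_empty fun z hz => (this hz.1).2 hz.2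

/-- Every path can be replaced by one whose fibers are order-connected. -/
theorem exists_path_ordConnected_fibers {X : Type*} [MetricSpace X] {f : I → X}
    (hf : Continuous f) : ∃ F : I → X, Continuous F ∧ F 0 = f 0 ∧ F 1 = f 1 ∧
      range F ⊆ range f ∧ ∀ s t u, s ≤ u → u ≤ t → F s = F t → F u = F s := by
  obtain ⟨K, hK, hmin⟩ := exists_isReduction_inter_Ioo_eq_empty hf
  have hk : ∀ t, ∃ z, IsGreatest (K ∩ Iic t) z := fun t =>
    (hK.isClosed.inter isClosed_Iic).isCompact.exists_isGreatest ⟨0, hK.zero_mem, t.2.1⟩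
  have hl : ∀ t, ∃ z, IsLeast (K ∩ Ici t) z := fun t =>
    (hK.isClosed.inter isClosed_Ici).isCompact.exists_isLeast ⟨1, hK.one_mem, t.2.2⟩
  choose k hk using hk
  choose l hl using hl
  have hkK : ∀ t ∈ K, k t = t := fun t ht => le_antisymm (hk t).1.2 ((hk t).2 ⟨ht, self_mem_Iic⟩)
  have hlK : ∀ t ∈ K, l t = t := fun t ht => le_antisymm ((hl t).2 ⟨ht, self_mem_Ici⟩) (hl t).1.2
  have hkl : ∀ t, f (k t) = f (l t) := by
    intro t
    by_cases ht : t ∈ K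
    · rw [hkK t ht, hlK t ht]
    · have h1 : k t < t := lt_of_le_of_ne (hk t).1.2 fun h => ht (h ▸ (hk t).1.1)
      have h2 : t < l t := lt_of_le_of_ne (hl t).1.2 fun h => ht (h ▸ (hl t).1.1)
      refine hK.eq_of_gap _ (hk t).1.1 _ (hl t).1.1 (h1.trans h2)
        (eq_empty_of_subset_empty fun z hz => ?_)
      rcases le_total z t with h | h
      · exact ((hk t).2 ⟨hz.2, h⟩).not_gt hz.1.1
      · exact ((hl t).2 ⟨hz.2, h⟩).not_gt hz.1.2
  have hkmono : Monotone k := fun s t hst => (hk t).2 ⟨(hk s).1.1, (hk s).1.2.trans hst⟩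
  refine ⟨fun t => f (k t), ?_, congrArg f (hkK 0 hK.zero_mem), congrArg f (hkK 1 hK.one_mem),
    range_subset_iff.2 fun t => mem_range_self _, fun s t u hsu hut hst => ?_⟩
  · have huc := CompactSpace.uniformContinuous_of_continuous hf
    refine UniformContinuous.continuous (Metric.uniformContinuous_iff.2 fun ε hε => ?_)
    obtain ⟨δ, hδ, H⟩ := Metric.uniformContinuous_iff.1 huc ε hε
    have main : ∀ s t : I, s ≤ t → dist s t < δ → dist (f (k s)) (f (k t)) < ε := by
      intro s t hst hd
      rcases le_or_gt s (k t) with h | h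
      · rw [hkl s]
        have h1 : l s ≤ k t := (hl s).2 ⟨(hk t).1.1, h⟩
        have h2 : s ≤ l s := (hl s).1.2
        have h3 : k t ≤ t := (hk t).1.2
        refine H (lt_of_le_of_lt ?_ hd)
        rw [Subtype.dist_eq, Subtype.dist_eq, Real.dist_eq, Real.dist_eq, abs_sub_comm,
          abs_sub_comm (s : ℝ),
          abs_of_nonneg (sub_nonneg.2 (show (l s : ℝ) ≤ k t from h1)),
          abs_of_nonneg (sub_nonneg.2 (show (s : ℝ) ≤ t from hst))]
        exact sub_le_sub h3 h2
      · rw [le_antisymm (hkmono hst) ((hk s).2 ⟨(hk t).1.1, h.le⟩), dist_self]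
        exact hε
    refine ⟨δ, hδ, fun s t hd => ?_⟩
    rcases le_total s t with h | h
    · exact main s t h hd
    · rw [dist_comm] at hd ⊢
      exact main t s h hd
  · change f (k u) = f (k s)
    change f (k s) = f (k t) at hst
    rcases (hkmono hsu).eq_or_lt with h | h
    · rw [h]
    · rcases (hkmono hut).eq_or_lt with h' | h'
      · rw [hst, h']
      · have := hmin _ (hk s).1.1 _ (hk t).1.1 (h.trans h') hst
        exact absurd (this.subset ⟨(hk u).1.1, h, h'⟩) (notMem_empty _)

theorem continuous_infDist_image_Iic {X : Type*} [MetricSpace X] {F : I → X} (hF : Continuous F)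
    (x : X) : Continuous fun t => infDist x (F '' Iic t) := by
  have hne : ∀ t, (F '' Iic t).Nonempty := fun t => ⟨F t, t, self_mem_Iic, rfl⟩
  have huc := CompactSpace.uniformContinuous_of_continuous hF
  refine UniformContinuous.continuous (Metric.uniformContinuous_iff.2 fun ε hε => ?_)
  obtain ⟨δ, hδ, H⟩ := Metric.uniformContinuous_iff.1 huc (ε / 2) (half_pos hε)
  have main : ∀ s t : I, s ≤ t → dist s t < δ →
      dist (infDist x (F '' Iic s)) (infDist x (F '' Iic t)) < ε := by
    intro s t hst hd
    have h1 : infDist x (F '' Iic t) ≤ infDist x (F '' Iic s) :=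
      infDist_le_infDist_of_subset (image_mono (Iic_subset_Iic.2 hst)) (hne s)
    have h2 : infDist x (F '' Iic s) - ε / 2 ≤ infDist x (F '' Iic t) := by
      refine (le_infDist (hne t)).2 ?_
      rintro _ ⟨u, hu, rfl⟩
      rcases le_total u s with h | h
      · linarith [infDist_le_dist_of_mem (x := x) (mem_image_of_mem F (mem_Iic.2 h))]
      · have hus : dist s u < δ := by
          refine lt_of_le_of_lt ?_ hd
          rw [Subtype.dist_eq, Subtype.dist_eq, Real.dist_eq, Real.dist_eq, abs_sub_comm,
            abs_sub_comm (s : ℝ),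
            abs_of_nonneg (sub_nonneg.2 (show (s : ℝ) ≤ u from h)),
            abs_of_nonneg (sub_nonneg.2 (show (s : ℝ) ≤ t from hst))]
          exact sub_le_sub_right (show (u : ℝ) ≤ t from hu) _
        have h3 := H hus
        have h4 := infDist_le_dist_of_mem (x := x) (mem_image_of_mem F (self_mem_Iic (a := s)))
        have h5 := dist_triangle_right x (F s) (F u)
        linarith [dist_triangle x (F u) (F s), dist_comm (F u) (F s)]
    rw [Real.dist_eq, abs_of_nonneg (sub_nonneg.2 h1)]
    linarith
  refine ⟨δ, hδ, fun s t hd => ?_⟩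
  rcases le_total s t with h | h
  · exact main s t h hd
  · rw [dist_comm] at hd ⊢
    exact main t s h hd

/-- A path with order-connected fibers has a continuous monotone reparametrization which separates
its fibers. -/
theorem exists_monotone_continuous_eq_iff {X : Type*} [MetricSpace X] [CompactSpace X] {F : I → X}
    (hF : Continuous F) (hfib : ∀ s t u, s ≤ u → u ≤ t → F s = F t → F u = F s) :
    ∃ W : I → ℝ, Continuous W ∧ Monotone W ∧ ∀ s t, W s = W t ↔ F s = F t := by
  have : Nonempty X := ⟨F 0⟩
  let x := TopologicalSpace.denseSeq X
  let w : ℕ → I → ℝ := fun n t => (1 / 2) ^ n * infDist (x n) (F '' Iic t)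
  have hne : ∀ t, (F '' Iic t).Nonempty := fun t => ⟨F t, t, self_mem_Iic, rfl⟩
  obtain ⟨C, hC⟩ := Metric.isBounded_iff.1 (isCompact_univ (X := X)).isBounded
  have hw : ∀ n t, ‖w n t‖ ≤ (1 / 2) ^ n * C := by
    intro n t
    rw [Real.norm_eq_abs, abs_of_nonneg (mul_nonneg (by positivity) infDist_nonneg)]
    refine mul_le_mul_of_nonneg_left ?_ (by positivity)
    exact (infDist_le_dist_of_mem (mem_image_of_mem F (self_mem_Iic (a := t)))).trans
      (hC (mem_univ _) (mem_univ _))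
  have hsum : Summable fun n : ℕ => (1 / 2 : ℝ) ^ n * C := summable_geometric_two.mul_right C
  have hws : ∀ t, Summable fun n => w n t := fun t => .of_norm_bounded hsum fun n => hw n t
  have hanti : ∀ n, Antitone (w n) := fun n s t hst => mul_le_mul_of_nonneg_left
    (infDist_le_infDist_of_subset (image_mono (Iic_subset_Iic.2 hst)) (hne s)) (by positivity)
  have hmono : Monotone fun t => -∑' n, w n t := fun s t hst =>
    neg_le_neg ((hws t).tsum_le_tsum (fun n => hanti n hst) (hws s))
  refine ⟨fun t => -∑' n, w n t, (continuous_tsum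
    (fun n => (continuous_infDist_image_Iic hF _).const_mul _) hsum hw).neg, hmono, ?_⟩
  have key : ∀ s t, s ≤ t → ((-∑' n, w n s = -∑' n, w n t) ↔ F s = F t) := by
    intro s t hst
    constructor
    · intro h
      have heq : ∀ n, infDist (x n) (F '' Iic t) = infDist (x n) (F '' Iic s) := by
        intro n
        by_contra hn
        have hlt : w n t < w n s := lt_of_le_of_ne (hanti n hst) fun e =>
          hn (mul_left_cancel₀ (by positivity) e)
        have := (hws t).tsum_lt_tsum (fun n => hanti n hst) hlt (hws s)
        linarith
      have heq' : (fun y => infDist y (F '' Iic t)) = fun y => infDist y (F '' Iic s) :=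
        (TopologicalSpace.denseRange_denseSeq X).equalizer (continuous_infDist_pt _)
          (continuous_infDist_pt _) (funext heq)
      have h0 : infDist (F t) (F '' Iic s) = 0 := by
        rw [← congrFun heq' (F t)]
        exact infDist_zero_of_mem ⟨t, self_mem_Iic, rfl⟩
      obtain ⟨u, hu, hut⟩ := ((isClosed_Iic.isCompact.image hF).isClosed.mem_iff_infDist_zero
        (hne s)).2 h0
      rw [hfib u t s hu hst hut, hut]
    · intro h
      have : F '' Iic t = F '' Iic s := by
        refine Subset.antisymm ?_ (image_mono (Iic_subset_Iic.2 hst))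
        rintro _ ⟨u, hu, rfl⟩
        rcases le_total u s with hus | hsu
        · exact ⟨u, hus, rfl⟩
        · exact ⟨s, self_mem_Iic, (hfib s t u hsu hu h).symm⟩
      simp only [w, this]
  intro s t
  rcases le_total s t with h | h
  · exact key s t h
  · rw [eq_comm, key t s h, eq_comm]

/-- Distinct points joined by a path in a compact metric space are joined by an arc. -/
theorem JoinedIn.exists_injective_path {X : Type*} [MetricSpace X] [CompactSpace X] {x y : X}
    {A : Set X} (h : JoinedIn A x y) (hxy : x ≠ y) :
    ∃ γ : Path x y, Function.Injective γ ∧ range γ ⊆ A := by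
  obtain ⟨f, hfA⟩ := h
  obtain ⟨F, hF, hF0, hF1, hFr, hfib⟩ := exists_path_ordConnected_fibers f.continuous
  rw [f.source] at hF0
  rw [f.target] at hF1
  obtain ⟨W, hW, hWm, hWF⟩ := exists_monotone_continuous_eq_iff hF hfib
  have h01 : W 0 < W 1 := lt_of_le_of_ne (hWm zero_le_one) fun h =>
    hxy (by rw [← hF0, ← hF1, (hWF 0 1).1 h])
  have hpos : 0 < W 1 - W 0 := sub_pos.2 h01
  let θ : I → I := fun t => ⟨(W t - W 0) / (W 1 - W 0),
    div_nonneg (sub_nonneg.2 (hWm t.2.1)) hpos.le,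
    (div_le_one hpos).2 (sub_le_sub_right (hWm t.2.2) _)⟩
  have hθ : Continuous θ := ((hW.sub continuous_const).div_const _).subtype_mk _
  have hθ0 : θ 0 = 0 := Subtype.ext (by simp [θ])
  have hθ1 : θ 1 = 1 := Subtype.ext (by simp [θ, hpos.ne'])
  have hθF : ∀ s t, θ s = θ t ↔ F s = F t := fun s t => by
    rw [← hWF, Subtype.ext_iff]
    change (W s - W 0) / (W 1 - W 0) = (W t - W 0) / (W 1 - W 0) ↔ _
    rw [div_left_inj' hpos.ne', sub_left_inj]
  have hθs : Function.Surjective θ := fun v =>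
    intermediate_value_univ 0 1 hθ (by rw [hθ0, hθ1]; exact v.2)
  have hq : IsQuotientMap θ := hθ.isClosedMap.isQuotientMap hθ hθs
  choose r hr using hθs
  have hrF : (F ∘ r) ∘ θ = F := funext fun t => (hθF _ _).1 (hr _)
  refine ⟨⟨⟨F ∘ r, hq.continuous_iff.2 (by rwa [hrF])⟩, ?_, ?_⟩, fun s t hst => ?_, ?_⟩
  · rw [← hF0, ← congrFun hrF 0, Function.comp_apply, hθ0]
  · rw [← hF1, ← congrFun hrF 1, Function.comp_apply, hθ1]
  · have := (hθF (r s) (r t)).2 hst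
    rwa [hr, hr] at this
  · rintro _ ⟨t, rfl⟩
    obtain ⟨s, hs⟩ := hFr (mem_range_self (r t))
    change F (r t) ∈ A
    rw [← hs]
    exact hfA s

theorem isSimpleClosedCurve_image_Ico {X : Type*} [TopologicalSpace X] [T2Space X] {f : ℝ → X}
    (hf : Continuous f) (hp : f 0 = f 2) (hinj : InjOn f (Ico 0 2)) :
    IsSimpleClosedCurve (f '' Ico 0 2) := by
  have : Fact ((0 : ℝ) < 2) := ⟨two_pos⟩
  let g : AddCircle (2 : ℝ) → X := AddCircle.liftIco 2 0 f
  have hg : Continuous g := AddCircle.liftIco_zero_continuous hp hf.continuousOn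
  have hi : Function.Injective g := by
    refine Function.Injective.comp (f := AddCircle.equivIco (2 : ℝ) 0) ?_ (Equiv.injective _)
    rw [zero_add]
    exact hinj.injective
  have hr : range g = f '' Ico 0 2 := by
    have : range g = range ((Ico (0 : ℝ) (0 + 2)).domRestrict f) :=
      (AddCircle.equivIco (2 : ℝ) 0).surjective.range_comp _
    rw [this, range_domRestrict, zero_add]
  rw [← hr]
  exact ⟨(hg.isClosedEmbedding hi).isEmbedding.toHomeomorph.symm.trans
    (AddCircle.homeomorphAddCircle 2 1 two_ne_zero one_ne_zero)⟩

/-- An arc with endpoints on a second arc and passing outside of it yields a simple closed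
curve. -/
theorem exists_isSimpleClosedCurve_of_arcs {X : Type*} [TopologicalSpace X] [T2Space X]
    {α β : I → X} (hα : Continuous α) (hαi : Function.Injective α) (hβ : Continuous β)
    (hβi : Function.Injective β) (h0 : α 0 ∈ range β) (h1 : α 1 ∈ range β) {t : I}
    (ht : α t ∉ range β) : ∃ S, IsSimpleClosedCurve S ∧ α t ∈ S := by
  have hc : IsClosed (α ⁻¹' range β) := (isCompact_range hβ).isClosed.preimage hα
  obtain ⟨a, ⟨⟨s', hs'⟩, hat⟩, ha⟩ := (hc.inter isClosed_Iic).isCompact.exists_isGreatest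
    (⟨0, h0, t.2.1⟩ : (α ⁻¹' range β ∩ Iic t).Nonempty)
  obtain ⟨b, ⟨⟨s, hs⟩, htb⟩, hb⟩ := (hc.inter isClosed_Ici).isCompact.exists_isLeast
    (⟨1, h1, t.2.2⟩ : (α ⁻¹' range β ∩ Ici t).Nonempty)
  have hat' : a < t := lt_of_le_of_ne hat fun h => ht (h ▸ ⟨s', hs'⟩)
  have htb' : t < b := lt_of_le_of_ne htb fun h => ht (h ▸ ⟨s, hs⟩)
  have hab : (a : ℝ) < b := hat'.trans htb'
  have hout : ∀ u : I, a < u → u < b → α u ∉ range β := fun u hau hub hu => by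
    rcases le_total u t with h | h
    · exact (ha ⟨hu, h⟩).not_gt hau
    · exact (hb ⟨hu, h⟩).not_gt hub
  have hss : (s : ℝ) ≠ s' := fun h => by
    rw [Subtype.ext h, hs'] at hs
    exact hab.ne (congrArg Subtype.val (hαi hs))
  let π : ℝ → I := projIcc 0 1 zero_le_one
  have hπ : ∀ v (hv : v ∈ Icc (0 : ℝ) 1), π v = ⟨v, hv⟩ := fun v hv => projIcc_of_mem _ hv
  let x : ℝ → ℝ := fun u => (1 - u) * a + u * b
  let y : ℝ → ℝ := fun u => (2 - u) * s + (u - 1) * s'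
  have hx : ∀ u ∈ Icc (0 : ℝ) 1, x u ∈ Icc (0 : ℝ) 1 := fun u hu =>
    convex_Icc (0 : ℝ) 1 a.2 b.2 (sub_nonneg.2 hu.2) hu.1 (by ring)
  have hy : ∀ u ∈ Icc (1 : ℝ) 2, y u ∈ Icc (0 : ℝ) 1 := fun u hu =>
    convex_Icc (0 : ℝ) 1 s.2 s'.2 (sub_nonneg.2 hu.2) (sub_nonneg.2 hu.1) (by ring)
  let f : ℝ → X := fun u => if u ≤ 1 then α (π (x u)) else β (π (y u))
  have hfx : ∀ u ≤ 1, f u = α (π (x u)) := fun u hu => if_pos hu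
  have hfy : ∀ u, 1 < u → f u = β (π (y u)) := fun u hu => if_neg hu.not_ge
  have hπc : Continuous π := continuous_projIcc
  have hf : Continuous f := by
    refine Continuous.if_le (by fun_prop) (by fun_prop) continuous_id continuous_const ?_
    rintro u rfl
    have h1 : x 1 = b := by simp [x]
    have h2 : y 1 = s := by simp [y]; ring
    rw [h1, h2, hπ _ b.2, hπ _ s.2, hs]
  have hf02 : f 0 = f 2 := by
    have h1 : x 0 = a := by simp [x]
    have h2 : y 2 = s' := by simp [y]; ring
    rw [hfx 0 zero_le_one, hfy 2 one_lt_two, h1, h2, hπ _ a.2, hπ _ s'.2, hs']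
  have hmixed : ∀ u ∈ Ico (0 : ℝ) 2, ∀ v ∈ Ico (0 : ℝ) 2, u ≤ 1 → 1 < v → f u ≠ f v := by
    intro u hu v hv hu1 hv1 h
    rw [hfx u hu1, hfy v hv1] at h
    have hxu := hx u ⟨hu.1, hu1⟩
    have hyv := hy v ⟨hv1.le, hv.2.le⟩
    have hau : (a : ℝ) ≤ x u := by simp only [x]; nlinarith [hu.1]
    have hub : x u ≤ b := by simp only [x]; nlinarith
    rw [hπ _ hxu] at h
    rcases hau.eq_or_lt with e | e
    · rw [show (⟨x u, hxu⟩ : I) = a from Subtype.ext e.symm, ← hs', hπ _ hyv] at h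
      have h3 : (s' : ℝ) = y v := congrArg Subtype.val (hβi h)
      have h4 : (2 - v) * ((s : ℝ) - s') = 0 := by simp only [y] at h3; linarith
      rcases mul_eq_zero.1 h4 with h5 | h5
      · linarith [hv.2]
      · exact hss (sub_eq_zero.1 h5)
    · rcases hub.eq_or_lt with e' | e'
      · rw [show (⟨x u, hxu⟩ : I) = b from Subtype.ext e', ← hs, hπ _ hyv] at h
        have h3 : (s : ℝ) = y v := congrArg Subtype.val (hβi h)
        have h4 : (v - 1) * ((s : ℝ) - s') = 0 := by simp only [y] at h3; linarith
        rcases mul_eq_zero.1 h4 with h5 | h5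
        · linarith
        · exact hss (sub_eq_zero.1 h5)
      · exact hout _ e e' ⟨_, h.symm⟩
  have hinj : InjOn f (Ico 0 2) := by
    intro u hu v hv h
    rcases le_or_gt u 1 with hu1 | hu1 <;> rcases le_or_gt v 1 with hv1 | hv1
    · rw [hfx u hu1, hfx v hv1, hπ _ (hx u ⟨hu.1, hu1⟩), hπ _ (hx v ⟨hv.1, hv1⟩)] at h
      have h3 : x u = x v := congrArg Subtype.val (hαi h)
      have h4 : (u - v) * ((b : ℝ) - a) = 0 := by simp only [x] at h3; linarith
      rcases mul_eq_zero.1 h4 with h5 | h5 <;> linarith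
    · exact absurd h (hmixed u hu v hv hu1 hv1)
    · exact absurd h.symm (hmixed v hv u hu hv1 hu1)
    · rw [hfy u hu1, hfy v hv1, hπ _ (hy u ⟨hu1.le, hu.2.le⟩), hπ _ (hy v ⟨hv1.le, hv.2.le⟩)] at h
      have h3 : y u = y v := congrArg Subtype.val (hβi h)
      have h4 : (v - u) * ((s : ℝ) - s') = 0 := by simp only [y] at h3; linarith
      rcases mul_eq_zero.1 h4 with h5 | h5
      · linarith
      · exact absurd (sub_eq_zero.1 h5) hss
  refine ⟨_, isSimpleClosedCurve_image_Ico hf hf02 hinj, ((t : ℝ) - a) / (b - a), ?_, ?_⟩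
  · have h3 : ((t : ℝ) - a) / (b - a) ≤ 1 :=
      (div_le_one (sub_pos.2 hab)).2 (sub_le_sub_right (show (t : ℝ) ≤ b from htb) _)
    exact ⟨div_nonneg (sub_nonneg.2 hat) (sub_pos.2 hab).le, by linarith⟩
  · have h3 : ((t : ℝ) - a) / (b - a) ≤ 1 :=
      (div_le_one (sub_pos.2 hab)).2 (sub_le_sub_right (show (t : ℝ) ≤ b from htb) _)
    have h4 : x (((t : ℝ) - a) / (b - a)) = t := by
      have := (sub_pos.2 hab).ne'
      simp only [x]
      field_simp
      ring
    rw [hfx _ h3, h4, hπ _ t.2]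

theorem IsLocalDendrite.locallyConnectedSpace {X : Type*} [TopologicalSpace X]
    (hX : IsLocalDendrite X) : LocallyConnectedSpace X := by
  refine locallyConnectedSpace_iff_connected_subsets.2 fun x U hU => ?_
  obtain ⟨N, hN, hd⟩ := hX.2 x
  have := hd.2.1
  have hx := mem_of_mem_nhds hN
  obtain ⟨V, hV, hVc, hVU⟩ := locallyConnectedSpace_iff_connected_subsets.1 this ⟨x, hx⟩
    (Subtype.val ⁻¹' U) (continuous_subtype_val.continuousAt.preimage_mem_nhds hU)
  refine ⟨Subtype.val '' V, ?_, hVc.image _ continuous_subtype_val.continuousOn,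
    image_subset_iff.2 hVU⟩
  have := image_mem_map (m := Subtype.val) hV
  rwa [map_nhds_subtype_val, nhdsWithin_eq_nhds.2 hN] at this

theorem closure_connectedComponentIn_inter_subset {X : Type*} [TopologicalSpace X] {F : Set X}
    {x : X} (hx : x ∈ F) : closure (connectedComponentIn F x) ∩ F ⊆ connectedComponentIn F x := by
  rintro y ⟨hy, hyF⟩
  have hpre : IsPreconnected (insert y (connectedComponentIn F x)) :=
    isPreconnected_connectedComponentIn.subset_closure (subset_insert _ _)
      (insert_subset hy subset_closure)
  exact hpre.subset_connectedComponentIn (mem_insert_of_mem _ (mem_connectedComponentIn hx))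
    (insert_subset hyF (connectedComponentIn_subset _ _)) (mem_insert _ _)

theorem closure_connectedComponentIn_compl_inter_nonempty {X : Type*} [TopologicalSpace X]
    [PreconnectedSpace X] [LocallyConnectedSpace X] {G : Set X} (hG : IsClosed G)
    (hne : G.Nonempty) {x : X} (hx : x ∉ G) :
    (closure (connectedComponentIn Gᶜ x) ∩ G).Nonempty := by
  by_contra h
  have hcl : closure (connectedComponentIn Gᶜ x) ⊆ connectedComponentIn Gᶜ x := fun y hy =>
    closure_connectedComponentIn_inter_subset hx ⟨hy, fun hyG => h ⟨y, hy, hyG⟩⟩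
  have hclopen : IsClopen (connectedComponentIn Gᶜ x) :=
    ⟨closure_subset_iff_isClosed.1 hcl, hG.isOpen_compl.connectedComponentIn⟩
  obtain ⟨g, hg⟩ := hne
  have huniv := hclopen.eq_univ ⟨x, mem_connectedComponentIn hx⟩
  exact connectedComponentIn_subset Gᶜ x (huniv ▸ mem_univ g) hg

/-- A component of the complement of a connected closed set containing every simple closed curve
accumulates at no more than one point of that set. -/
theorem closure_connectedComponentIn_compl_inter_subsingleton {X : Type*} [TopologicalSpace X]
    [CompactSpace X] [TopologicalSpace.MetrizableSpace X] [LocallyConnectedSpace X] {G : Set X}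
    (hG : IsClosed G) (hGc : IsPreconnected G) (hscc : ∀ S : Set X, IsSimpleClosedCurve S → S ⊆ G)
    {x : X} (hx : x ∉ G) : (closure (connectedComponentIn Gᶜ x) ∩ G).Subsingleton := by
  let _ := TopologicalSpace.metrizableSpaceMetric X
  have := LocallyPathConnectedSpace.of_compactSpace_of_locallyConnectedSpace (X := X)
  rintro p ⟨hpC, hpG⟩ q ⟨hqC, hqG⟩
  by_contra hpq
  obtain ⟨U, V, hU, hV, hpU, hqV, hUV⟩ := t2_separation hpq
  obtain ⟨P, hPU, hP, hpP, hPc⟩ := locallyConnectedSpace_iff_subsets_isOpen_isConnected.1 ‹_› p U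
    (hU.mem_nhds hpU)
  obtain ⟨Q, hQV, hQ, hqQ, hQc⟩ := locallyConnectedSpace_iff_subsets_isOpen_isConnected.1 ‹_› q V
    (hV.mem_nhds hqV)
  have hPQ : Disjoint P Q := hUV.mono hPU hQV
  obtain ⟨p', hp'P, hp'C⟩ := mem_closure_iff.1 hpC P hP hpP
  obtain ⟨q', hq'Q, hq'C⟩ := mem_closure_iff.1 hqC Q hQ hqQ
  have hCo : IsOpen (connectedComponentIn Gᶜ x) := hG.isOpen_compl.connectedComponentIn
  have hne : p' ≠ q' := hPQ.ne_of_mem hp'P hq'Q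
  obtain ⟨α, hαi, hαC⟩ := ((hCo.isConnected_iff_isPathConnected.1
    (isConnected_connectedComponentIn_iff.2 hx)).joinedIn p' hp'C q' hq'C).exists_injective_path hne
  obtain ⟨t, htP, htQ⟩ : ∃ t, α t ∉ P ∧ α t ∉ Q := by
    by_contra! hcov
    obtain ⟨z, -, hz⟩ := (isPreconnected_range α.continuous) P Q hP hQ
      (by rintro _ ⟨t, rfl⟩; exact or_iff_not_imp_left.2 (hcov t))
      ⟨p', ⟨0, α.source⟩, hp'P⟩ ⟨q', ⟨1, α.target⟩, hq'Q⟩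
    exact hPQ.ne_of_mem hz.1 hz.2 rfl
  have htG : α t ∉ G := connectedComponentIn_subset Gᶜ x (hαC (mem_range_self t))
  have hW : IsConnected (P ∪ G ∪ Q) :=
    (hPc.union ⟨p, hpP, hpG⟩ ⟨⟨p, hpG⟩, hGc⟩).union ⟨q, .inr hqG, hqQ⟩ hQc
  have hWt : P ∪ G ∪ Q ⊆ {α t}ᶜ := by
    rintro y ((hy | hy) | hy) rfl
    exacts [htP hy, htG hy, htQ hy]
  have hWsub : P ∪ G ∪ Q ⊆ connectedComponentIn {α t}ᶜ p :=
    hW.isPreconnected.subset_connectedComponentIn (.inl (.inl hpP)) hWt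
  have hDo : IsOpen (connectedComponentIn {α t}ᶜ p) :=
    isClosed_singleton.isOpen_compl.connectedComponentIn
  obtain ⟨β, hβi, hβ⟩ := ((hDo.isConnected_iff_isPathConnected.1
    (isConnected_connectedComponentIn_iff.2 (hWt (.inl (.inl hpP))))).joinedIn p'
      (hWsub (.inl (.inl hp'P))) q' (hWsub (.inr hq'Q))).exists_injective_path hne
  obtain ⟨S, hS, htS⟩ := exists_isSimpleClosedCurve_of_arcs α.continuous hαi β.continuous hβi
    ⟨0, β.source.trans α.source.symm⟩ ⟨1, β.target.trans α.target.symm⟩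
    (fun h => connectedComponentIn_subset _ _ (hβ h) rfl : α t ∉ range β)
  exact htG (hscc S hS htS)

theorem IsSimpleClosedCurve.nontrivial {X : Type*} [TopologicalSpace X] {S : Set X}
    (hS : IsSimpleClosedCurve S) : S.Nontrivial := by
  obtain ⟨e⟩ := hS
  have : Fact ((0 : ℝ) < 1) := ⟨one_pos⟩
  have : Nontrivial (AddCircle (1 : ℝ)) :=
    (AddCircle.equivIco (1 : ℝ) 0).nontrivial_congr.2
      (nontrivial_coe_sort.2 ⟨0, by norm_num, 1 / 2, by norm_num, by norm_num⟩)
  exact nontrivial_coe_sort.1 (e.toEquiv.nontrivial_congr.2 this)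

theorem IsSimpleClosedCurve.image_val {X : Type*} [TopologicalSpace X] {A : Set X} {S : Set A}
    (hS : IsSimpleClosedCurve S) : IsSimpleClosedCurve (Subtype.val '' S : Set X) :=
  hS.map fun e => (IsEmbedding.subtypeVal.homeomorphImage S).symm.trans e

/-- The closure of an open set with at most one boundary point is a retract, hence locally
connected. -/
theorem IsOpen.locallyConnectedSpace_closure {X : Type*} [TopologicalSpace X]
    [LocallyConnectedSpace X] {C : Set X} (hC : IsOpen C) {p : X} (hp : p ∈ closure C)
    (hfr : closure C \ C ⊆ {p}) : LocallyConnectedSpace (closure C) := by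
  classical
  let r : X → X := fun y => if y ∈ closure C then y else p
  have hr : Continuous r := by
    refine continuous_if (fun y hy => ?_) continuousOn_id continuousOn_const
    have hy' : y ∈ frontier (closure C) := hy
    refine hfr ⟨by simpa using hy'.1, fun hyC => hy'.2 ?_⟩
    exact interior_maximal subset_closure hC hyC
  have hrC : ∀ y, r y ∈ closure C := fun y => by
    by_cases hy : y ∈ closure C
    · simp [r, hy]
    · simpa [r, hy] using hp
  have hq : IsQuotientMap (codRestrict r (closure C) hrC) :=
    .of_inverse (f := ((↑) : closure C → X)) continuous_subtype_val (hr.codRestrict hrC)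
      fun y => Subtype.ext (if_pos y.2)
  exact hq.isCoinducing.locallyConnectedSpace

end

/-- If `G` is a proper subcontinuum of a local dendrite `X` containing every
simple closed curve, and `C` is a connected component of `X ∖ G`, then `C` is open,
its closure is a dendrite, and its closure meets `G` in exactly one point. -/
theorem component_of_complement_of_subcontinuum
    {X : Type u} [TopologicalSpace X] (hX : IsLocalDendrite X)
    (G : Set X) (hG : IsContinuum G) (hproper : G ≠ Set.univ)
    (hscc : ∀ S : Set X, IsSimpleClosedCurve S → S ⊆ G)
    (x : X) (hx : x ∉ G) :
    IsOpen (connectedComponentIn Gᶜ x) ∧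
    IsDendrite ↥(closure (connectedComponentIn Gᶜ x)) ∧
    ∃ p : X, closure (connectedComponentIn Gᶜ x) ∩ G = {p} := by
  have hlc := hX.locallyConnectedSpace
  obtain ⟨⟨-, hcomp, hconn, hmet⟩, -⟩ := hX
  obtain ⟨hGne, hGcomp, hGconn, -⟩ := hG
  have hGcl : IsClosed G := (isCompact_iff_compactSpace.2 hGcomp).isClosed
  have hC : IsOpen (connectedComponentIn Gᶜ x) := hGcl.isOpen_compl.connectedComponentIn
  obtain ⟨p, hp⟩ := closure_connectedComponentIn_compl_inter_nonempty hGcl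
    (Set.nonempty_coe_sort.1 hGne) hx
  have hss := closure_connectedComponentIn_compl_inter_subsingleton hGcl
    (isConnected_iff_connectedSpace.2 hGconn).isPreconnected hscc hx
  refine ⟨hC, ⟨⟨⟨p, hp.1⟩, isCompact_iff_compactSpace.1 isClosed_closure.isCompact,
    isConnected_iff_connectedSpace.1 (isConnected_connectedComponentIn_iff.2 hx).closure,
    inferInstance⟩, hC.locallyConnectedSpace_closure hp.1 fun y hy => ?_, fun S hS => ?_⟩, p,
    hss.eq_singleton_of_mem hp⟩
  · refine hss ⟨hy.1, ?_⟩ hp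
    by_contra hyG
    exact hy.2 (closure_connectedComponentIn_inter_subset hx ⟨hy.1, hyG⟩)
  · refine hS.image_val.nontrivial.not_subsingleton (hss.anti fun y hy => ?_)
    exact ⟨(Subtype.coe_image_subset _ S) hy, hscc _ hS.image_val hy⟩
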